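/- arXiv:1807.06469 — 10 statements merged into one kernel-verified Lean document; each statement's English description precedes it below -/
import Mathlib

section
/- Let p = a/b > 1 where a and b are coprime positive integers with a > b, and let n̂ be a positive integer. Let N = (2^b + 2)·n̂ and let S be the family of binary strings of length N consisting of one copy of the string 1^((2^b+1)·n̂) ∘ 0^(n̂) together with 2^(a−b) copies of the all-zero string 0^N. If a binary string s* of length N satisfies hd(s*, 0^N) ≠ n̂, or some position where s* differs from 0^N lies outside the first (2^b+1)·n̂ positions, then the sum over all strings s of S (counted with multiplicity) of hd(s*, s)^p is strictly greater than (2^a + 2^(a−b))·n̂^p. -/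
/-- The convex function `x ↦ x ^ p` lies strictly above its tangent at `c`, away from `c`. -/
lemma rpow_tangent_lt {p c x : ℝ} (hp : 1 < p) (hc : 0 < c) (hx : 0 ≤ x) (hxc : x ≠ c) :
    c ^ p + p * c ^ (p - 1) * (x - c) < x ^ p := by
  have hs : x / c - 1 ≠ 0 := by
    rw [sub_ne_zero, Ne, div_eq_one_iff_eq hc.ne']
    exact hxc
  have h := one_add_mul_self_lt_rpow_one_add (s := x / c - 1)
    (by linarith [div_nonneg hx hc.le]) hs hp
  rw [add_sub_cancel, Real.div_rpow hx hc.le, lt_div_iff₀ (Real.rpow_pos_of_pos hc p)] at h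
  refine lt_of_eq_of_lt ?_ h
  rw [Real.rpow_sub_one hc.ne']
  field_simp

lemma rpow_tangent_le {p c x : ℝ} (hp : 1 < p) (hc : 0 < c) (hx : 0 ≤ x) :
    c ^ p + p * c ^ (p - 1) * (x - c) ≤ x ^ p := by
  rcases eq_or_ne x c with rfl | hxc
  · simp
  · exact (rpow_tangent_lt hp hc hx hxc).le

lemma card_fin_val_lt {N k : ℕ} (hk : k ≤ N) :
    ∑ i : Fin N, (if (i : ℕ) < k then 1 else 0) = k := by
  rw [← Finset.card_filter, Fin.card_filter_val_lt, min_eq_right hk]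

lemma le_hammingDist_add {N k : ℕ} (hk : k ≤ N) (s : Fin N → Bool) :
    k ≤ hammingDist s (fun i => decide ((i : ℕ) < k)) + hammingDist s (fun _ => false) := by
  simp only [hammingDist, Finset.card_filter, ← Finset.sum_add_distrib]
  conv_lhs => rw [← card_fin_val_lt hk]
  refine Finset.sum_le_sum fun i _ => ?_
  by_cases hi : (i : ℕ) < k <;> cases hs : s i <;> simp [hi]

lemma lt_hammingDist_add {N k : ℕ} (hk : k ≤ N) (s : Fin N → Bool)
    (h : ∃ i : Fin N, s i = true ∧ ¬ (i : ℕ) < k) :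
    k < hammingDist s (fun i => decide ((i : ℕ) < k)) + hammingDist s (fun _ => false) := by
  simp only [hammingDist, Finset.card_filter, ← Finset.sum_add_distrib]
  conv_lhs => rw [← card_fin_val_lt hk]
  refine Finset.sum_lt_sum (fun i _ => ?_) ?_
  · by_cases hi : (i : ℕ) < k <;> cases hs : s i <;> simp [hi]
  · obtain ⟨i, hs, hi⟩ := h
    exact ⟨i, Finset.mem_univ i, by simp [hs, hi]⟩

theorem stmt_1 (a b : ℕ) (hb : 0 < b) (hab : b < a) (hcop : Nat.Coprime a b)
    (nh : ℕ) (hnh : 0 < nh)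
    (sstar : Fin ((2 ^ b + 2) * nh) → Bool)
    (h : hammingDist sstar (fun _ => false) ≠ nh ∨
      ∃ i : Fin ((2 ^ b + 2) * nh), sstar i = true ∧ ¬ ((i : ℕ) < (2 ^ b + 1) * nh)) :
    (2 ^ a + 2 ^ (a - b)) * (nh : ℝ) ^ ((a : ℝ) / b)
      < (hammingDist sstar (fun i => decide ((i : ℕ) < (2 ^ b + 1) * nh)) : ℝ) ^ ((a : ℝ) / b)
        + 2 ^ (a - b) * (hammingDist sstar (fun _ => false) : ℝ) ^ ((a : ℝ) / b) := by
  have hk : (2 ^ b + 1) * nh ≤ (2 ^ b + 2) * nh := Nat.mul_le_mul_right _ (by omega)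
  have hle := le_hammingDist_add hk sstar
  have hlt := lt_hammingDist_add hk sstar
  generalize hammingDist sstar (fun i => decide ((i : ℕ) < (2 ^ b + 1) * nh)) = x at *
  generalize hammingDist sstar (fun _ => false) = y at *
  have hb' : (0 : ℝ) < b := by exact_mod_cast hb
  have hn : (0 : ℝ) < nh := by exact_mod_cast hnh
  have hp : 1 < (a : ℝ) / b := by
    rw [one_lt_div hb']
    exact_mod_cast hab
  have hpow : ((2 : ℝ) ^ b) ^ ((a : ℝ) / b) = 2 ^ a := by
    rw [← Real.rpow_natCast, ← Real.rpow_mul zero_le_two, mul_div_cancel₀ _ hb'.ne',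
      Real.rpow_natCast]
  have hpow' : ((2 : ℝ) ^ b) ^ ((a : ℝ) / b - 1) = 2 ^ (a - b) := by
    rw [Real.rpow_sub_one (by positivity), hpow, pow_sub₀ _ two_ne_zero hab.le, div_eq_mul_inv]
  generalize (a : ℝ) / b = p at *
  have hX := rpow_tangent_le (c := 2 ^ b * nh) hp (by positivity) (Nat.cast_nonneg (α := ℝ) x)
  rw [Real.mul_rpow (by positivity) hn.le, Real.mul_rpow (by positivity) hn.le, hpow, hpow'] at hX
  have hr : 0 < p * (2 ^ (a - b) * (nh : ℝ) ^ (p - 1)) := by positivity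
  have hA : (0 : ℝ) < 2 ^ (a - b) := by positivity
  have hle' : 0 ≤ (x : ℝ) + y - (2 ^ b + 1) * nh := by
    rw [sub_nonneg]
    exact_mod_cast hle
  rcases h with h | h
  · have hY := mul_lt_mul_of_pos_left (rpow_tangent_lt hp hn (Nat.cast_nonneg (α := ℝ) y)
      (by exact_mod_cast h)) hA
    linarith [mul_nonneg hr.le hle']
  · have hY := mul_le_mul_of_nonneg_left (rpow_tangent_le hp hn (Nat.cast_nonneg (α := ℝ) y)) hA.le
    have hlt' : 0 < (x : ℝ) + y - (2 ^ b + 1) * nh := by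
      rw [sub_pos]
      exact_mod_cast hlt h
    linarith [mul_pos hr hlt']
end

section
/- Let s1 and s2 be two binary strings of equal length R whose Hamming distance satisfies hd(s1, s2) = 2L for a natural number L, and let p > 1 be a rational number. Then for every binary string ŝ of length R, hd(ŝ, s1)^p + hd(ŝ, s2)^p ≥ 2·L^p. -/
theorem stmt_3 (R L : ℕ) (s1 s2 : Fin R → Bool) (hL : hammingDist s1 s2 = 2 * L)
    (p : ℚ) (hp : 1 < p) (shat : Fin R → Bool) :
    2 * (L : ℝ) ^ (p : ℝ)
      ≤ (hammingDist shat s1 : ℝ) ^ (p : ℝ) + (hammingDist shat s2 : ℝ) ^ (p : ℝ) := by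
  have h_one_le : (1 : ℝ) ≤ p := by exact_mod_cast hp.le
  have h_tri : 2 * (L : ℝ) ≤ hammingDist shat s1 + hammingDist shat s2 := by
    exact_mod_cast hL ▸ hammingDist_triangle_left s1 s2 shat
  have h_convex := (convexOn_rpow h_one_le).2
    (Set.mem_Ici.2 (Nat.cast_nonneg (hammingDist shat s1)))
    (Set.mem_Ici.2 (Nat.cast_nonneg (hammingDist shat s2)))
    (by norm_num : (0 : ℝ) ≤ 1 / 2) (by norm_num : (0 : ℝ) ≤ 1 / 2) (by norm_num)
  simp only [smul_eq_mul] at h_convex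
  have h_mono : (L : ℝ) ^ (p : ℝ) ≤
      (1 / 2 * (hammingDist shat s1 : ℝ) + 1 / 2 * (hammingDist shat s2 : ℝ)) ^ (p : ℝ) :=
    Real.rpow_le_rpow (Nat.cast_nonneg L) (by linarith) (by linarith)
  linarith
end

section
/- Let s1 and s2 be two binary strings of equal length R whose Hamming distance satisfies hd(s1, s2) = 2L for a natural number L, and let p > 1 be a rational number. Then for every binary string ŝ of length R with hd(ŝ, s1) ≠ L or hd(ŝ, s2) ≠ L, it holds that hd(ŝ, s1)^p + hd(ŝ, s2)^p > 2·L^p. -/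
theorem two_mul_rpow_lt_rpow_add_rpow {p x y z : ℝ} (hp : 1 < p) (hx : 0 ≤ x) (hy : 0 ≤ y)
    (hz : 0 ≤ z) (hxyz : 2 * z ≤ x + y) (hne : x ≠ z ∨ y ≠ z) :
    2 * z ^ p < x ^ p + y ^ p := by
  rcases eq_or_ne x y with rfl | hxy
  · have hlt : z < x := lt_of_le_of_ne (by linarith) (by tauto)
    have := Real.rpow_lt_rpow hz hlt (by linarith : 0 < p)
    linarith
  · have hconv := (strictConvexOn_rpow hp).2 (Set.mem_Ici.2 hx) (Set.mem_Ici.2 hy) hxy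
      (by norm_num : (0 : ℝ) < 1 / 2) (by norm_num : (0 : ℝ) < 1 / 2) (by norm_num)
    simp only [smul_eq_mul] at hconv
    have hmono : z ^ p ≤ (1 / 2 * x + 1 / 2 * y) ^ p :=
      Real.rpow_le_rpow hz (by linarith) (by linarith)
    linarith

theorem stmt_4 (R L : ℕ) (s1 s2 : Fin R → Bool) (hL : hammingDist s1 s2 = 2 * L)
    (p : ℚ) (hp : 1 < p) (shat : Fin R → Bool)
    (h : hammingDist shat s1 ≠ L ∨ hammingDist shat s2 ≠ L) :
    2 * (L : ℝ) ^ (p : ℝ)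
      < (hammingDist shat s1 : ℝ) ^ (p : ℝ) + (hammingDist shat s2 : ℝ) ^ (p : ℝ) := by
  have htri := hammingDist_triangle_left s1 s2 shat
  rw [hL] at htri
  exact two_mul_rpow_lt_rpow_add_rpow (by exact_mod_cast hp) (by positivity) (by positivity)
    (by positivity) (by exact_mod_cast htri) (by exact_mod_cast h)
end

section
/- Let p > 1 be a rational number and n̂ a positive integer. Let s* and s be binary strings of length 4·n̂ such that (i) s* has exactly n̂ ones, all occurring among the first 3·n̂ positions, and (ii) s has exactly 3 ones among its first 3·n̂ positions and its last n̂ positions form the string 0 ∘ 1^(n̂−1). If there is exactly one position ℓ with s*[ℓ] = s[ℓ] = 1 (i.e., s* covers s exactly once), then hd(s*, s)^p + hd(s*, s̄)^p = 2·(2·n̂)^p, where s̄ denotes the bitwise complement of s. -/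
theorem hammingDist_add_two_mul_card_inter {ι : Type*} [Fintype ι] (a b : ι → Bool) :
    hammingDist a b + 2 * (Finset.univ.filter fun i => a i = true ∧ b i = true).card
      = (Finset.univ.filter fun i => a i = true).card
        + (Finset.univ.filter fun i => b i = true).card := by
  simp only [hammingDist, Finset.card_filter, Finset.mul_sum, ← Finset.sum_add_distrib]
  refine Finset.sum_congr rfl fun i _ => ?_
  cases a i <;> cases b i <;> simp

theorem hammingDist_add_hammingDist_not {ι : Type*} [Fintype ι] (a b : ι → Bool) :
    hammingDist a b + hammingDist a (fun i => !b i) = Fintype.card ι := by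
  simp only [hammingDist, Finset.card_filter, ← Finset.sum_add_distrib]
  rw [← Finset.card_univ, Finset.card_eq_sum_ones]
  refine Finset.sum_congr rfl fun i _ => ?_
  cases a i <;> cases b i <;> simp


theorem stmt_5 (p : ℚ) (hp : 1 < p) (nh : ℕ) (hnh : 0 < nh)
    (sstar s : Fin (4 * nh) → Bool)
    (h1 : (Finset.univ.filter fun i : Fin (4 * nh) => sstar i = true).card = nh)
    (h2 : ∀ i : Fin (4 * nh), sstar i = true → (i : ℕ) < 3 * nh)
    (h3 : (Finset.univ.filter fun i : Fin (4 * nh) => s i = true ∧ (i : ℕ) < 3 * nh).card = 3)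
    (h4 : ∀ i : Fin (4 * nh), 3 * nh ≤ (i : ℕ) → s i = decide ((i : ℕ) ≠ 3 * nh))
    (hcov : ∃! ℓ : Fin (4 * nh), sstar ℓ = true ∧ s ℓ = true) :
    (hammingDist sstar s : ℝ) ^ (p : ℝ) + (hammingDist sstar (fun i => !s i) : ℝ) ^ (p : ℝ)
      = 2 * (2 * (nh : ℝ)) ^ (p : ℝ) := by
  have htail : (Finset.univ.filter fun i : Fin (4 * nh) =>
      s i = true ∧ ¬ (i : ℕ) < 3 * nh).card = nh - 1 := by
    have himage : (Finset.univ.filter fun i : Fin (4 * nh) =>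
        s i = true ∧ ¬ (i : ℕ) < 3 * nh).map Fin.valEmbedding
        = Finset.Ioo (3 * nh) (4 * nh) := by
      ext k
      simp only [Finset.mem_map, Finset.mem_filter, Finset.mem_univ, true_and,
        Fin.valEmbedding_apply, Finset.mem_Ioo]
      constructor
      · rintro ⟨i, ⟨hi, hlt⟩, rfl⟩
        rw [h4 i (not_lt.mp hlt), decide_eq_true_eq] at hi
        omega
      · rintro ⟨hk, hk'⟩
        refine ⟨⟨k, hk'⟩, ⟨?_, hk.le.not_gt⟩, rfl⟩
        rw [h4 ⟨k, hk'⟩ hk.le, decide_eq_true_eq]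
        exact hk.ne'
    rw [← Finset.card_map Fin.valEmbedding, himage, Nat.card_Ioo]
    omega
  have hones : (Finset.univ.filter fun i : Fin (4 * nh) => s i = true).card = nh + 2 := by
    rw [← Finset.card_filter_add_card_filter_not (fun i : Fin (4 * nh) => (i : ℕ) < 3 * nh),
      Finset.filter_filter, Finset.filter_filter, h3, htail]
    omega
  have hinter : (Finset.univ.filter fun i : Fin (4 * nh) =>
      sstar i = true ∧ s i = true).card = 1 := by
    obtain ⟨l, hl, huniq⟩ := hcov
    refine Finset.card_eq_one.mpr ⟨l, ?_⟩
    ext i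
    simp only [Finset.mem_filter, Finset.mem_univ, true_and, Finset.mem_singleton]
    exact ⟨huniq i, fun h => h ▸ hl⟩
  have hsum := hammingDist_add_two_mul_card_inter sstar s
  have hcompl := hammingDist_add_hammingDist_not sstar s
  rw [hinter, h1, hones] at hsum
  rw [Fintype.card_fin] at hcompl
  have hd : hammingDist sstar s = 2 * nh := by omega
  have hd' : hammingDist sstar (fun i => !s i) = 2 * nh := by omega
  rw [hd, hd']
  push_cast
  ring
end

section
/- Let p > 1 be a rational number, let S = (s_1, …, s_m) be a nonempty finite family of binary strings of length n, and let s_1 be (after reindexing) a member of S that minimizes the quantity Σ_{s ∈ S} hd(s_i, s)^p over all members s_i of S. Then for every binary string s* of length n, Σ_{s ∈ S} hd(s_1, s)^p ≤ 2^p · Σ_{s ∈ S} hd(s*, s)^p. Consequently, an input string with minimum sum of p-distances to the input is a factor-2 approximation for minimizing the p-norm of the Hamming distance vector. -/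
theorem stmt_9 (p : ℚ) (hp : 1 < p) (n m : ℕ) (hm : 0 < m)
    (s : Fin m → Fin n → Bool)
    (hmin : ∀ i : Fin m,
      ∑ j : Fin m, (hammingDist (s ⟨0, hm⟩) (s j) : ℝ) ^ (p : ℝ)
        ≤ ∑ j : Fin m, (hammingDist (s i) (s j) : ℝ) ^ (p : ℝ))
    (sstar : Fin n → Bool) :
    ∑ j : Fin m, (hammingDist (s ⟨0, hm⟩) (s j) : ℝ) ^ (p : ℝ)
      ≤ (2 : ℝ) ^ (p : ℝ) * ∑ j : Fin m, (hammingDist sstar (s j) : ℝ) ^ (p : ℝ) := by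
  have : Nonempty (Fin m) := ⟨⟨0, hm⟩⟩
  have hp0 : (0 : ℝ) ≤ p := by exact_mod_cast (zero_lt_one.trans hp).le
  -- Compare with the member of the family closest to `sstar`.
  obtain ⟨i, hi⟩ := Finite.exists_min fun j => hammingDist sstar (s j)
  refine (hmin i).trans ?_
  rw [Finset.mul_sum]
  refine Finset.sum_le_sum fun j _ => ?_
  rw [← Real.mul_rpow zero_le_two (Nat.cast_nonneg _)]
  refine Real.rpow_le_rpow (Nat.cast_nonneg _) ?_ hp0
  have htri := hammingDist_triangle_left (s i) (s j) sstar
  have hclosest := hi j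
  exact_mod_cast (by lia : hammingDist (s i) (s j) ≤ 2 * hammingDist sstar (s j))
end

section
/- Let p > 1 be a rational number, let S = (s_1, …, s_m) be a nonempty finite family of binary strings of length n, let s* be a binary string of length n, and write OPT^p = Σ_{s ∈ S} hd(s*, s)^p. If ŝ is a member of S with hd(ŝ, s*)^p ≤ OPT^p / m, then Σ_{s ∈ S} hd(ŝ, s)^p ≤ 2^p · OPT^p. -/
theorem Real.natCast_add_rpow_le (a b : ℕ) {p : ℝ} (hp : 1 ≤ p) :
    ((a : ℝ) + b) ^ p ≤ 2 ^ (p - 1) * ((a : ℝ) ^ p + (b : ℝ) ^ p) := by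
  exact_mod_cast NNReal.rpow_add_le_mul_rpow_add_rpow (a : NNReal) b hp

theorem stmt_10 (p : ℚ) (hp : 1 < p) (n m : ℕ) (hm : 0 < m)
    (s : Fin m → Fin n → Bool) (sstar : Fin n → Bool) (i0 : Fin m)
    (hshat : (hammingDist (s i0) sstar : ℝ) ^ (p : ℝ)
      ≤ (∑ j : Fin m, (hammingDist sstar (s j) : ℝ) ^ (p : ℝ)) / m) :
    ∑ j : Fin m, (hammingDist (s i0) (s j) : ℝ) ^ (p : ℝ)
      ≤ (2 : ℝ) ^ (p : ℝ) * ∑ j : Fin m, (hammingDist sstar (s j) : ℝ) ^ (p : ℝ) := by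
  have hp1 : (1 : ℝ) ≤ (p : ℝ) := by exact_mod_cast hp.le
  have hm0 : (0 : ℝ) < m := by exact_mod_cast hm
  rw [le_div_iff₀ hm0] at hshat
  calc ∑ j : Fin m, (hammingDist (s i0) (s j) : ℝ) ^ (p : ℝ)
      ≤ ∑ j : Fin m, (2 : ℝ) ^ ((p : ℝ) - 1) * ((hammingDist (s i0) sstar : ℝ) ^ (p : ℝ)
          + (hammingDist sstar (s j) : ℝ) ^ (p : ℝ)) := by
        gcongr with j
        refine le_trans ?_ (Real.natCast_add_rpow_le _ _ hp1)
        gcongr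
        exact_mod_cast hammingDist_triangle (s i0) sstar (s j)
    _ = (2 : ℝ) ^ ((p : ℝ) - 1) * ((hammingDist (s i0) sstar : ℝ) ^ (p : ℝ) * m
          + ∑ j : Fin m, (hammingDist sstar (s j) : ℝ) ^ (p : ℝ)) := by
        simp [← Finset.mul_sum, Finset.sum_add_distrib, mul_comm]
    _ ≤ (2 : ℝ) ^ ((p : ℝ) - 1) * (∑ j : Fin m, (hammingDist sstar (s j) : ℝ) ^ (p : ℝ)
          + ∑ j : Fin m, (hammingDist sstar (s j) : ℝ) ^ (p : ℝ)) := by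
        gcongr
    _ = (2 : ℝ) ^ (p : ℝ) * ∑ j : Fin m, (hammingDist sstar (s j) : ℝ) ^ (p : ℝ) := by
        rw [Real.rpow_sub_one two_ne_zero]
        ring
end

section
/- Let p ≥ 1 be a rational number and let S = (s_1, …, s_m) be a nonempty finite family of binary strings of length n such that every column is non-constant, i.e., for every position j ∈ {1,…,n} there exist members s, s' of S with s[j] ≠ s'[j]. Then for every binary string s* of length n, Σ_{s ∈ S} hd(s*, s)^p ≥ n. -/
theorem Nat.cast_le_rpow_of_one_le (k : ℕ) {q : ℝ} (hq : 1 ≤ q) : (k : ℝ) ≤ (k : ℝ) ^ q := by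
  rcases Nat.eq_zero_or_pos k with rfl | hk
  · simpa using Real.rpow_nonneg le_rfl q
  · exact Real.self_le_rpow_of_one_le (by exact_mod_cast hk) hq

/-- If no column of `s` is constant, every column of `s` contains a disagreement with `t`, so the
Hamming distances from `t` add up to at least the number of columns. -/
theorem card_le_sum_hammingDist {ι κ α : Type*} [Fintype ι] [Fintype κ] [DecidableEq α]
    (s : ι → κ → α) (hcol : ∀ j, ∃ i i', s i j ≠ s i' j) (t : κ → α) :
    Fintype.card κ ≤ ∑ i, hammingDist t (s i) := by
  classical
  have hcover : (Finset.univ : Finset κ) ⊆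
      Finset.univ.biUnion fun i => Finset.univ.filter fun j => t j ≠ s i j := by
    intro j _
    obtain ⟨i, i', h⟩ := hcol j
    simp only [Finset.mem_biUnion, Finset.mem_filter, Finset.mem_univ, true_and]
    by_contra! hc
    exact h ((hc i).symm.trans (hc i'))
  exact (Finset.card_le_card hcover).trans Finset.card_biUnion_le

theorem stmt_12 (p : ℚ) (hp : 1 ≤ p) (n m : ℕ) (hm : 0 < m)
    (s : Fin m → Fin n → Bool)
    (hcol : ∀ j : Fin n, ∃ i i' : Fin m, s i j ≠ s i' j)
    (sstar : Fin n → Bool) :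
    (n : ℝ) ≤ ∑ i : Fin m, (hammingDist sstar (s i) : ℝ) ^ (p : ℝ) := by
  calc (n : ℝ) ≤ ∑ i : Fin m, (hammingDist sstar (s i) : ℝ) := by
        exact_mod_cast (Fintype.card_fin n).symm.trans_le (card_le_sum_hammingDist s hcol sstar)
    _ ≤ _ := Finset.sum_le_sum fun i _ => Nat.cast_le_rpow_of_one_le _ (by exact_mod_cast hp)
end

section
/- Let p > 1 be a rational number and let S = (s_1, …, s_m) be a nonempty finite family of binary strings of length n such that all members of S agree on position j, having common value c there. Let s* be a binary string of length n with s*[j] ≠ c, and let s*' be the string obtained from s* by setting position j to c and leaving all other positions unchanged. Then Σ_{s ∈ S} hd(s*', s)^p < Σ_{s ∈ S} hd(s*, s)^p. -/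
/-- Correcting a wrong coordinate strictly decreases the Hamming distance. -/
theorem hammingDist_update_lt {ι : Type*} [Fintype ι] [DecidableEq ι] {β : ι → Type*}
    [∀ i, DecidableEq (β i)] {x y : ∀ i, β i} {j : ι} (h : x j ≠ y j) :
    hammingDist (Function.update x j (y j)) y < hammingDist x y := by
  unfold hammingDist
  refine Finset.card_lt_card (Finset.ssubset_iff_of_subset ?_ |>.2 ⟨j, by simpa using h, by simp⟩)
  intro i hi
  rcases eq_or_ne i j with rfl | hij
  · simp at hi
  · simpa [hij] using hi

theorem stmt_13 (p : ℚ) (hp : 1 < p) (n m : ℕ) (hm : 0 < m)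
    (s : Fin m → Fin n → Bool) (j : Fin n) (c : Bool)
    (hcol : ∀ i : Fin m, s i j = c)
    (sstar : Fin n → Bool) (hs : sstar j ≠ c) :
    ∑ i : Fin m, (hammingDist (Function.update sstar j c) (s i) : ℝ) ^ (p : ℝ)
      < ∑ i : Fin m, (hammingDist sstar (s i) : ℝ) ^ (p : ℝ) := by
  have hp0 : (0 : ℝ) < p := by exact_mod_cast zero_lt_one.trans hp
  refine Finset.sum_lt_sum_of_nonempty ⟨⟨0, hm⟩, Finset.mem_univ _⟩ fun i _ => ?_
  refine Real.rpow_lt_rpow (Nat.cast_nonneg _) (Nat.cast_lt.2 ?_) hp0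
  rw [← hcol i] at hs ⊢
  exact hammingDist_update_lt hs
end

section
/- Let p = a/b > 1 where a and b are coprime positive integers with a > b, and let n̂ be a positive integer. Then for every real x with 0 ≤ x ≤ (2^b+1)·n̂ + 2^b + 1, it holds that 2^(a−b)·x^p + ((2^b+1)·n̂ + 2^b + 1 − x)^p ≥ (2^a + 2^(a−b))·(n̂+1)^p, with the minimum attained at x = n̂ + 1. -/
/-- The graph of `y ↦ y ^ p` with `1 ≤ p` lies above its tangent line at `t`. -/
theorem rpow_mul_one_add_le_rpow {p t y : ℝ} (hp : 1 ≤ p) (ht : 0 < t) (hy : 0 ≤ y) :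
    t ^ p * (1 + p * (y / t - 1)) ≤ y ^ p := by
  have hyt : 0 ≤ y / t := by positivity
  have h := one_add_mul_self_le_rpow_one_add (s := y / t - 1) (by linarith) hp
  rw [add_sub_cancel] at h
  calc t ^ p * (1 + p * (y / t - 1)) ≤ t ^ p * (y / t) ^ p := by gcongr
    _ = y ^ p := by rw [← Real.mul_rpow ht.le hyt, mul_div_cancel₀ _ ht.ne']

theorem two_pow_mul_rpow_div {a b : ℕ} (hb : b ≠ 0) {m : ℝ} (hm : 0 ≤ m) :
    (2 ^ b * m) ^ ((a : ℝ) / b) = 2 ^ a * m ^ ((a : ℝ) / b) := by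
  have hb' : (b : ℝ) ≠ 0 := Nat.cast_ne_zero.mpr hb
  rw [Real.mul_rpow (by positivity) hm, ← Real.rpow_natCast 2 b,
    ← Real.rpow_mul (by norm_num), mul_div_cancel₀ _ hb', Real.rpow_natCast]

theorem stmt_14 (a b : ℕ) (hb : 0 < b) (hab : b < a) (hcop : Nat.Coprime a b)
    (nh : ℕ) (hnh : 0 < nh) :
    (∀ x : ℝ, 0 ≤ x → x ≤ (2 ^ b + 1) * (nh : ℝ) + 2 ^ b + 1 →
      (2 ^ a + 2 ^ (a - b)) * ((nh : ℝ) + 1) ^ ((a : ℝ) / b)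
        ≤ 2 ^ (a - b) * x ^ ((a : ℝ) / b)
          + ((2 ^ b + 1) * (nh : ℝ) + 2 ^ b + 1 - x) ^ ((a : ℝ) / b))
    ∧ 2 ^ (a - b) * ((nh : ℝ) + 1) ^ ((a : ℝ) / b)
        + ((2 ^ b + 1) * (nh : ℝ) + 2 ^ b + 1 - ((nh : ℝ) + 1)) ^ ((a : ℝ) / b)
      = (2 ^ a + 2 ^ (a - b)) * ((nh : ℝ) + 1) ^ ((a : ℝ) / b) := by
  have hm : (0 : ℝ) < nh + 1 := by positivity
  have hS : (2 ^ b + 1) * (nh : ℝ) + 2 ^ b + 1 = (2 ^ b + 1) * (nh + 1) := by ring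
  rw [hS]
  generalize (nh : ℝ) + 1 = m at hm
  have hpow : (2 : ℝ) ^ a = 2 ^ (a - b) * 2 ^ b := by
    rw [← pow_add, Nat.sub_add_cancel hab.le]
  have hp : 1 ≤ (a : ℝ) / b := by
    rw [one_le_div (by positivity)]
    exact_mod_cast hab.le
  have hBm := two_pow_mul_rpow_div (a := a) hb.ne' hm.le
  constructor
  · intro x hx hxS
    have h₁ := rpow_mul_one_add_le_rpow hp hm hx
    have h₂ := rpow_mul_one_add_le_rpow hp (t := 2 ^ b * m) (by positivity) (sub_nonneg.mpr hxS)
    rw [hBm] at h₂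
    refine le_trans (le_of_eq ?_)
      (add_le_add (mul_le_mul_of_nonneg_left h₁ (by positivity : (0 : ℝ) ≤ 2 ^ (a - b))) h₂)
    generalize m ^ ((a : ℝ) / b) = M
    generalize (a : ℝ) / b = p
    rw [hpow]
    field_simp
    ring
  · rw [show (2 ^ b + 1) * m - m = 2 ^ b * m by ring, hBm]
    ring
end

section
/- Let p = a/b > 1 where a and b are coprime positive integers with a > b, and let n̂ be a positive integer. Define g(y) = ((2^b+1)·n̂ − y + 2^b)^p + 2^(a−b)·(y+1)^p for real y in the interval [0, (2^b+1)·n̂]. Then for every y in this interval, g(y) ≥ (2^a + 2^(a−b))·(n̂+1)^p, with equality if and only if y = n̂. -/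
/-- A weighted combination of two Bernoulli inequalities whose linear terms cancel. -/
theorem add_lt_mul_one_sub_div_rpow_add_mul_one_add_rpow {A B p s : ℝ} (hA : 0 < A) (hB : 0 < B)
    (hp : 1 < p) (hs : -1 ≤ s) (hsB : s ≤ B) (hs0 : s ≠ 0) :
    A * B + A < A * B * (1 - s / B) ^ p + A * (1 + s) ^ p := by
  have h1 : 1 + p * (-(s / B)) < (1 + -(s / B)) ^ p :=
    one_add_mul_self_lt_rpow_one_add (by have := (div_le_one hB).2 hsB; linarith)
      (neg_ne_zero.2 (div_ne_zero hs0 hB.ne')) hp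
  have h2 : 1 + p * s < (1 + s) ^ p := one_add_mul_self_lt_rpow_one_add hs hs0 hp
  have h3 := mul_lt_mul_of_pos_left h1 (mul_pos hA hB)
  have h4 := mul_lt_mul_of_pos_left h2 hA
  have h5 : A * B * (1 + p * (-(s / B))) + A * (1 + p * s) = A * B + A := by
    field_simp
    ring
  rw [sub_eq_add_neg]
  linarith

theorem two_pow_rpow_div (a b : ℕ) (hb : b ≠ 0) :
    ((2 : ℝ) ^ b) ^ ((a : ℝ) / b) = 2 ^ a := by
  rw [← Real.rpow_natCast, ← Real.rpow_mul zero_le_two,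
    mul_div_cancel₀ _ (Nat.cast_ne_zero.2 hb), Real.rpow_natCast]

theorem stmt_16 (a b : ℕ) (hb : 0 < b) (hab : b < a) (hcop : Nat.Coprime a b)
    (nh : ℕ) (hnh : 0 < nh)
    (y : ℝ) (hy0 : 0 ≤ y) (hy1 : y ≤ (2 ^ b + 1) * (nh : ℝ)) :
    (2 ^ a + 2 ^ (a - b)) * ((nh : ℝ) + 1) ^ ((a : ℝ) / b)
      ≤ ((2 ^ b + 1) * (nh : ℝ) - y + 2 ^ b) ^ ((a : ℝ) / b)
        + 2 ^ (a - b) * (y + 1) ^ ((a : ℝ) / b)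
    ∧ (((2 ^ b + 1) * (nh : ℝ) - y + 2 ^ b) ^ ((a : ℝ) / b)
          + 2 ^ (a - b) * (y + 1) ^ ((a : ℝ) / b)
        = (2 ^ a + 2 ^ (a - b)) * ((nh : ℝ) + 1) ^ ((a : ℝ) / b) ↔ y = nh) := by
  have hp : 1 < (a : ℝ) / b := (one_lt_div (by exact_mod_cast hb)).2 (by exact_mod_cast hab)
  have hN : (0 : ℝ) < nh + 1 := by positivity
  have hB : (0 : ℝ) < 2 ^ b := by positivity
  have hpow : (2 : ℝ) ^ (a - b) * 2 ^ b = 2 ^ a := pow_sub_mul_pow 2 hab.le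
  by_cases hy : y = nh
  · have hx : (2 ^ b + 1) * (nh : ℝ) - nh + 2 ^ b = 2 ^ b * (nh + 1) := by ring
    have heq : ((2 ^ b + 1) * (nh : ℝ) - y + 2 ^ b) ^ ((a : ℝ) / b)
        + 2 ^ (a - b) * (y + 1) ^ ((a : ℝ) / b)
        = (2 ^ a + 2 ^ (a - b)) * ((nh : ℝ) + 1) ^ ((a : ℝ) / b) := by
      rw [hy, hx, Real.mul_rpow hB.le hN.le, two_pow_rpow_div a b hb.ne', add_mul]
    exact ⟨heq.ge, iff_of_true heq hy⟩
  · set s : ℝ := (y - nh) / (nh + 1) with hs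
    have hs1 : -1 ≤ s := by
      rw [hs, le_div_iff₀ hN]
      linarith
    have hsB : s ≤ 2 ^ b := by
      rw [hs, div_le_iff₀ hN]
      linarith
    have ht : y + 1 = (nh + 1) * (1 + s) := by
      rw [hs]
      field_simp
      ring
    have hx : (2 ^ b + 1) * (nh : ℝ) - y + 2 ^ b = 2 ^ b * ((nh + 1) * (1 - s / 2 ^ b)) := by
      rw [hs]
      field_simp
      ring
    have hx0 : 0 ≤ 1 - s / 2 ^ b := sub_nonneg.2 ((div_le_one hB).2 hsB)
    have key := mul_lt_mul_of_pos_right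
      (add_lt_mul_one_sub_div_rpow_add_mul_one_add_rpow (A := 2 ^ (a - b)) (by positivity) hB hp
        hs1 hsB (div_ne_zero (sub_ne_zero.2 hy) hN.ne')) (Real.rpow_pos_of_pos hN ((a : ℝ) / b))
    have hlt : (2 ^ a + 2 ^ (a - b)) * ((nh : ℝ) + 1) ^ ((a : ℝ) / b)
        < ((2 ^ b + 1) * (nh : ℝ) - y + 2 ^ b) ^ ((a : ℝ) / b)
          + 2 ^ (a - b) * (y + 1) ^ ((a : ℝ) / b) := by
      rw [hx, ht, Real.mul_rpow hB.le (by positivity), two_pow_rpow_div a b hb.ne',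
        Real.mul_rpow hN.le hx0, Real.mul_rpow hN.le (by linarith)]
      rw [hpow] at key
      linarith
    exact ⟨hlt.le, iff_of_false hlt.ne' hy⟩
end
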